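/- Let 𝒯 be a stubborn set assignment satisfying D0, D1 and D2. Then the system is AG EF terminating (from every reachable state a terminal state is reachable) if and only if the reduced state space is AG EF terminating (from every r-state a terminal state is reachable along r-edges). -/

import Mathlib

/-- `TPath step s σ s'` means `s →[σ] s'`: firing the sequence `σ` of transitions
from `s` yields `s'`. -/
inductive TPath {S T : Type*} (step : S → T → S → Prop) : S → List T → S → Prop
  | nil (s : S) : TPath step s [] s
  | cons {s s' s'' : S} {t : T} {σ : List T} :
      step s t s' → TPath step s' σ s'' → TPath step s (t :: σ) s''

/-- Transition `t` is enabled at `s`. -/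
def Enabled {S T : Type*} (step : S → T → S → Prop) (s : S) (t : T) : Prop :=
  ∃ s', step s t s'

/-- A state is terminal iff no transition is enabled at it. -/
def Terminal {S T : Type*} (step : S → T → S → Prop) (s : S) : Prop :=
  ∀ t, ¬ Enabled step s t

/-- `s'` is reachable from `s`. -/
def Reachable {S T : Type*} (step : S → T → S → Prop) (s s' : S) : Prop :=
  ∃ σ, TPath step s σ s'

/-- An r-edge: a step `s →[t] s'` with `t ∈ 𝒯 s`. -/
def REdge {S T : Type*} (step : S → T → S → Prop) (𝒯 : S → Set T)
    (s : S) (t : T) (s' : S) : Prop :=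
  step s t s' ∧ t ∈ 𝒯 s

/-- The transition relation is deterministic. -/
def Deterministic {S T : Type*} (step : S → T → S → Prop) : Prop :=
  ∀ s t s₁ s₂, step s t s₁ → step s t s₂ → s₁ = s₂

/-- D0: if `s₀` is not terminal then `𝒯 s₀` contains an enabled transition. -/
def D0 {S T : Type*} (step : S → T → S → Prop) (𝒯 : S → Set T) : Prop :=
  ∀ s₀, ¬ Terminal step s₀ → ∃ t ∈ 𝒯 s₀, Enabled step s₀ t

/-- D1: if `t ∈ 𝒯 s₀`, `t₁,…,tₙ ∉ 𝒯 s₀` and `s₀ →[t₁⋯tₙ t] s'`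
then `s₀ →[t t₁⋯tₙ] s'`. -/
def D1 {S T : Type*} (step : S → T → S → Prop) (𝒯 : S → Set T) : Prop :=
  ∀ s₀ t σ s', t ∈ 𝒯 s₀ → (∀ u ∈ σ, u ∉ 𝒯 s₀) →
    TPath step s₀ (σ ++ [t]) s' → TPath step s₀ (t :: σ) s'

/-- D2: if `t ∈ 𝒯 s₀` is enabled at `s₀`, `t₁,…,tₙ ∉ 𝒯 s₀` and `s₀ →[t₁⋯tₙ] sₙ`
then `t` is enabled at `sₙ`. -/
def D2 {S T : Type*} (step : S → T → S → Prop) (𝒯 : S → Set T) : Prop :=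
  ∀ s₀ t σ sₙ, t ∈ 𝒯 s₀ → Enabled step s₀ t → (∀ u ∈ σ, u ∉ 𝒯 s₀) →
    TPath step s₀ σ sₙ → Enabled step sₙ t

section

variable {S T : Type*} {step : S → T → S → Prop} {𝒯 : S → Set T}

theorem TPath.append {s s' s'' : S} {σ τ : List T} (h : TPath step s σ s')
    (h' : TPath step s' τ s'') : TPath step s (σ ++ τ) s'' := by
  induction h with
  | nil => exact h'
  | cons hs _ ih => exact .cons hs (ih h')

theorem TPath.exists_of_append {s s'' : S} {σ τ : List T} (h : TPath step s (σ ++ τ) s'') :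
    ∃ s', TPath step s σ s' ∧ TPath step s' τ s'' := by
  induction σ generalizing s with
  | nil => exact ⟨s, .nil s, h⟩
  | cons t σ ih =>
    cases h with
    | cons hs hp =>
      obtain ⟨s', h₁, h₂⟩ := ih hp
      exact ⟨s', .cons hs h₁, h₂⟩

theorem TPath.mono {step' : S → T → S → Prop} (hle : ∀ s t s', step s t s' → step' s t s')
    {s s' : S} {σ : List T} (h : TPath step s σ s') : TPath step' s σ s' := by
  induction h with
  | nil s => exact .nil s
  | cons hs _ ih => exact .cons (hle _ _ _ hs) ih

theorem Reachable.trans {s s' s'' : S} (h : Reachable step s s')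
    (h' : Reachable step s' s'') : Reachable step s s'' := by
  obtain ⟨σ, h⟩ := h
  obtain ⟨τ, h'⟩ := h'
  exact ⟨σ ++ τ, h.append h'⟩

theorem Reachable.single {s s' : S} {t : T} (h : step s t s') : Reachable step s s' :=
  ⟨[t], .cons h (.nil s')⟩

theorem Reachable.of_rEdge {s s' : S} (h : Reachable (REdge step 𝒯) s s') :
    Reachable step s s' := by
  obtain ⟨σ, h⟩ := h
  exact ⟨σ, h.mono fun _ _ _ hr => hr.1⟩

theorem Terminal.eq_of_tPath {s s' : S} {σ : List T} (hs : Terminal step s)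
    (h : TPath step s σ s') : s' = s := by
  cases h with
  | nil => rfl
  | cons hs' _ => exact absurd ⟨_, hs'⟩ (hs _)

theorem List.exists_first_mem_of_exists_mem {A : Set T} {σ : List T} (h : ∃ u ∈ σ, u ∈ A) :
    ∃ σ₁ t σ₂, σ = σ₁ ++ t :: σ₂ ∧ t ∈ A ∧ ∀ u ∈ σ₁, u ∉ A := by
  induction σ with
  | nil => simp at h
  | cons a σ ih =>
    by_cases ha : a ∈ A
    · exact ⟨[], a, σ, rfl, ha, by simp⟩
    · obtain ⟨σ₁, t, σ₂, rfl, ht, hσ₁⟩ := ih (by simpa [ha] using h)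
      exact ⟨a :: σ₁, t, σ₂, rfl, ht, by simpa [ha] using hσ₁⟩

/-- If a path contains a stubborn transition, then the first one can be moved to the front. -/
theorem D1.exists_rEdge_of_exists_mem (h1 : D1 step 𝒯) {s s' : S} {σ : List T}
    (h : TPath step s σ s') (hσ : ∃ u ∈ σ, u ∈ 𝒯 s) :
    ∃ t s₁ τ, REdge step 𝒯 s t s₁ ∧ TPath step s₁ τ s' ∧ τ.length < σ.length := by
  obtain ⟨σ₁, t, σ₂, rfl, ht, hσ₁⟩ := List.exists_first_mem_of_exists_mem hσ
  rw [List.append_cons] at h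
  obtain ⟨m, hm, hm'⟩ := h.exists_of_append
  cases h1 s t σ₁ m ht hσ₁ hm with
  | cons hs hp => exact ⟨t, _, σ₁ ++ σ₂, ⟨hs, ht⟩, hp.append hm', by simp⟩

/-- The reduced state space preserves the reachability of terminal states. -/
theorem Reachable.rEdge_of_terminal (h0 : D0 step 𝒯) (h1 : D1 step 𝒯) (h2 : D2 step 𝒯)
    {s s' : S} (h : Reachable step s s') (hs' : Terminal step s') :
    Reachable (REdge step 𝒯) s s' := by
  obtain ⟨σ, h⟩ := h
  induction hn : σ.length using Nat.strong_induction_on generalizing s σ with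
  | _ n ih =>
    by_cases hs : Terminal step s
    · rw [hs.eq_of_tPath h]
      exact ⟨[], .nil s⟩
    · obtain ⟨t, ht, hten⟩ := h0 s hs
      have hσ : ∃ u ∈ σ, u ∈ 𝒯 s := by
        by_contra! hσ
        exact hs' t (h2 s t σ s' ht hten hσ h)
      obtain ⟨u, s₁, τ, hu, hτ, hlt⟩ := h1.exists_rEdge_of_exists_mem h hσ
      exact (Reachable.single hu).trans (ih _ (hn ▸ hlt) τ hτ rfl)

/-- If the reduced state space from `s` is AG EF terminating, then every state reachable from `s`
can reach a terminal state. -/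
theorem exists_terminal_reachable_of_rEdge (hdet : Deterministic step) (h1 : D1 step 𝒯)
    (h2 : D2 step 𝒯) {s s' : S} (h : Reachable step s s')
    (hr : ∀ r, Reachable (REdge step 𝒯) s r →
      ∃ q, Terminal step q ∧ Reachable (REdge step 𝒯) r q) :
    ∃ q, Terminal step q ∧ Reachable step s' q := by
  obtain ⟨σ, h⟩ := h
  induction hn : σ.length using Nat.strong_induction_on generalizing s s' σ with
  | _ n ih =>
    obtain ⟨q, hq, ρ, hρ⟩ := hr s ⟨[], .nil s⟩
    induction hρ generalizing s' with
    | nil s => exact ⟨s, hq, by rw [hq.eq_of_tPath h]; exact ⟨[], .nil s⟩⟩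
    | @cons s s₁ _ t _ hs _ ihρ =>
      by_cases hσ : ∃ u ∈ σ, u ∈ 𝒯 s
      · obtain ⟨u, r, τ, hu, hτ, hlt⟩ := h1.exists_rEdge_of_exists_mem h hσ
        exact ih _ (hn ▸ hlt) (fun p hp => hr p ((Reachable.single hu).trans hp)) τ hτ rfl
      · push Not at hσ
        obtain ⟨s'', hs''⟩ := h2 s t σ s' hs.2 ⟨s₁, hs.1⟩ hσ h
        cases h1 s t σ s'' hs.2 hσ (h.append (.cons hs'' (.nil s''))) with
        | cons hst hp =>
          rw [hdet _ _ _ _ hst hs.1] at hp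
          obtain ⟨p, hpt, hpr⟩ :=
            ihρ (fun r hrr => hr r ((Reachable.single hs).trans hrr)) hp hq
          exact ⟨p, hpt, (Reachable.single hs'').trans hpr⟩

end

/-- Theorem 2: the basic strong stubborn set method preserves the property
"AG EF terminating". -/
theorem stmt5 {S T : Type*} (step : S → T → S → Prop) (𝒯 : S → Set T) (sHat : S)
    (hdet : Deterministic step) (h0 : D0 step 𝒯) (h1 : D1 step 𝒯) (h2 : D2 step 𝒯) :
    (∀ s, Reachable step sHat s →
        ∃ s_t, Terminal step s_t ∧ Reachable step s s_t) ↔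
      (∀ s, Reachable (REdge step 𝒯) sHat s →
        ∃ s_t, Terminal step s_t ∧ Reachable (REdge step 𝒯) s s_t) := by
  refine ⟨fun h s hs => ?_, fun h s hs => exists_terminal_reachable_of_rEdge hdet h1 h2 hs h⟩
  obtain ⟨q, hq, hsq⟩ := h s hs.of_rEdge
  exact ⟨q, hq, hsq.rEdge_of_terminal h0 h1 h2 hq⟩
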